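/- Let p ≥ 2 be a natural number, c > 0 a real number, and f : ℝ → ℝ continuous on [0,1] and twice continuously differentiable on (0,1], with f(x) = c·x^p + o(x^p) and f″(x) = c·p·(p−1)·x^(p−2) + o(x^(p−2)) as x → 0⁺. Then ε^(4−p) · (∫₀^ε f″(x)² dx) / (∫₀^ε f(x) dx) → c·p²·(p−1)²·(p+1)/(2p−3) as ε → 0⁺. In particular, for p ∈ {2,3} the quotient of fourth-order stiffness to row-sum lumped mass of the cut part diverges as ε → 0⁺, while for p ≥ 4 it remains bounded. -/

import Mathlib

open MeasureTheory Filter Set Topology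

theorem aux_int (n : ℕ) (L : ℝ) (g : ℝ → ℝ) (hg : ContinuousOn g (Ioc 0 1))
    (h : Tendsto (fun x => (g x - L * x ^ n) / x ^ n) (𝓝[>] (0:ℝ)) (𝓝 0)) :
    Tendsto (fun ε => (∫ x in (0:ℝ)..ε, g x) / ε ^ (n + 1)) (𝓝[>] (0:ℝ))
      (𝓝 (L / ((n : ℝ) + 1))) := by
  rw [Metric.tendsto_nhds]
  intro δ hδ
  have h1 := (Metric.tendsto_nhds.1 h) (δ / 2) (by positivity)
  rw [eventually_nhdsWithin_iff, Metric.eventually_nhds_iff] at h1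
  obtain ⟨r, hr, h1⟩ := h1
  have hmem : Ioo (0:ℝ) (min r 1) ∈ 𝓝[>] (0:ℝ) := Ioo_mem_nhdsGT (by positivity)
  filter_upwards [hmem] with ε hε
  obtain ⟨h0, hε2⟩ := hε
  have her : ε < r := lt_of_lt_of_le hε2 (min_le_left _ _)
  have he1 : ε < 1 := lt_of_lt_of_le hε2 (min_le_right _ _)
  have hb : ∀ x ∈ Ioc (0:ℝ) ε, ‖g x - L * x ^ n‖ ≤ δ / 2 * x ^ n := by
    intro x hx
    have hx0 : 0 < x := hx.1
    have := h1 (y := x) (by rw [Real.dist_eq, sub_zero, abs_of_pos hx0]; linarith [hx.2]) hx0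
    rw [Real.dist_eq, sub_zero, abs_div, abs_of_pos (pow_pos hx0 n),
      div_lt_iff₀ (pow_pos hx0 n)] at this
    exact this.le
  have hi1 : IntervalIntegrable (fun x : ℝ => δ / 2 * x ^ n) volume 0 ε :=
    (by fun_prop : Continuous (fun x : ℝ => δ / 2 * x ^ n)).intervalIntegrable _ _
  have hi2 : IntervalIntegrable (fun x : ℝ => L * x ^ n) volume 0 ε :=
    (by fun_prop : Continuous (fun x : ℝ => L * x ^ n)).intervalIntegrable _ _
  have hi3 : IntervalIntegrable (fun x : ℝ => g x - L * x ^ n) volume 0 ε := by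
    rw [intervalIntegrable_iff_integrableOn_Ioc_of_le h0.le] at hi1 ⊢
    refine Integrable.mono' hi1 ?_ ?_
    · refine ContinuousOn.aestronglyMeasurable ?_ measurableSet_Ioc
      refine (hg.mono (Ioc_subset_Ioc_right he1.le)).sub ?_
      fun_prop
    · exact (ae_restrict_iff' measurableSet_Ioc).2 (Eventually.of_forall hb)
  have hi4 : ∫ x in (0:ℝ)..ε, g x
      = (∫ x in (0:ℝ)..ε, (g x - L * x ^ n)) + ∫ x in (0:ℝ)..ε, L * x ^ n := by
    rw [← intervalIntegral.integral_add hi3 hi2]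
    simp
  have hle : ‖∫ x in (0:ℝ)..ε, (g x - L * x ^ n)‖ ≤ ∫ x in (0:ℝ)..ε, δ / 2 * x ^ n :=
    intervalIntegral.norm_integral_le_of_norm_le h0.le (Eventually.of_forall hb) hi1
  rw [intervalIntegral.integral_const_mul, integral_pow] at hle
  rw [hi4, intervalIntegral.integral_const_mul, integral_pow]
  simp only [ne_eq, Nat.succ_ne_zero, not_false_eq_true, zero_pow, sub_zero] at hle ⊢
  set I := ∫ x in (0:ℝ)..ε, (g x - L * x ^ n)
  have hE : 0 < ε ^ (n + 1) := pow_pos h0 _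
  have hn : (0:ℝ) < (n:ℝ) + 1 := by positivity
  have : (I + L * (ε ^ (n + 1) / ((n:ℝ) + 1))) / ε ^ (n + 1) - L / ((n:ℝ) + 1)
      = I / ε ^ (n + 1) := by
    field_simp
    ring
  rw [Real.dist_eq, this, abs_div, abs_of_pos hE, div_lt_iff₀ hE]
  rw [Real.norm_eq_abs] at hle
  have h2 : ε ^ (n + 1) / ((n:ℝ) + 1) ≤ ε ^ (n + 1) :=
    div_le_self hE.le (by linarith [(Nat.cast_nonneg n : (0:ℝ) ≤ n)])
  nlinarith

/-- With `f x = c·x^p + o(x^p)` and `f″ x = c·p·(p−1)·x^(p−2) + o(x^(p−2))`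
as `x → 0⁺` (`p ≥ 2`, `c > 0`), the quotient of fourth-order stiffness against
row-sum lumped mass satisfies
`ε^(4−p) · (∫₀^ε f″² dx)/(∫₀^ε f dx) → c·p²·(p−1)²·(p+1)/(2p−3)` as `ε → 0⁺`. -/
theorem rayleigh_fourth_order_lumped_mass
    (p : ℕ) (hp : 2 ≤ p) (c : ℝ) (hc : 0 < c) (f : ℝ → ℝ)
    (hf : ContinuousOn f (Icc 0 1))
    (hdf : DifferentiableOn ℝ f (Ioc 0 1))
    (hdf2 : DifferentiableOn ℝ (deriv f) (Ioc 0 1))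
    (hdf2' : ContinuousOn (deriv (deriv f)) (Ioc 0 1))
    (hasymp : Tendsto (fun x => (f x - c * x ^ p) / x ^ p) (𝓝[>] (0:ℝ)) (𝓝 0))
    (hasymp2 : Tendsto
      (fun x => (deriv (deriv f) x - c * (p : ℝ) * ((p : ℝ) - 1) * x ^ (p - 2)) /
        x ^ (p - 2))
      (𝓝[>] (0:ℝ)) (𝓝 0)) :
    Tendsto (fun ε =>
        ε ^ ((4 : ℤ) - (p : ℤ)) * (∫ x in (0:ℝ)..ε, (deriv (deriv f) x) ^ 2) /
          (∫ x in (0:ℝ)..ε, f x))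
      (𝓝[>] (0:ℝ))
      (𝓝 (c * (p : ℝ) ^ 2 * ((p : ℝ) - 1) ^ 2 * ((p : ℝ) + 1) / (2 * (p : ℝ) - 3))) := by
  have hA := aux_int p c f (hf.mono Ioc_subset_Icc_self) hasymp
  set g := deriv (deriv f) with hgdef
  set K : ℝ := c * (p : ℝ) * ((p : ℝ) - 1) with hK
  have hB := aux_int (2 * (p - 2)) (K ^ 2) (fun x => g x ^ 2) (hdf2'.pow 2) (by
    have h2 := (hasymp2.mul (hasymp2.add_const (2 * K)))
    rw [zero_mul] at h2
    refine h2.congr' ?_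
    filter_upwards [self_mem_nhdsWithin] with x hx
    have hx0 : x ^ (p - 2) ≠ 0 := pow_ne_zero _ (ne_of_gt hx)
    rw [mul_comm 2 (p - 2), pow_mul]
    field_simp
    ring)
  have hp1 : (0:ℝ) < (p:ℝ) + 1 := by positivity
  have hC := hB.div hA (by positivity)
  have hp2 : (2:ℝ) ≤ p := by exact_mod_cast hp
  obtain ⟨q, rfl⟩ := Nat.exists_eq_add_of_le hp
  have hlim : K ^ 2 / (((2 * (2 + q - 2) : ℕ) : ℝ) + 1) / (c / (((2 + q : ℕ) : ℝ) + 1)) =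
      c * ((2 + q : ℕ) : ℝ) ^ 2 * (((2 + q : ℕ) : ℝ) - 1) ^ 2 * (((2 + q : ℕ) : ℝ) + 1) /
        (2 * ((2 + q : ℕ) : ℝ) - 3) := by
    have e : 2 * ((2 + q : ℕ) : ℝ) - 3 = ((2 * (2 + q - 2) : ℕ) : ℝ) + 1 := by
      rw [Nat.add_sub_cancel_left]; push_cast; ring
    rw [e, hK]
    field_simp
  rw [hlim] at hC
  refine hC.congr' ?_
  filter_upwards [self_mem_nhdsWithin] with x hx
  have hx0 : x ≠ 0 := ne_of_gt hx
  have e : x ^ ((4 : ℤ) - ((2 + q : ℕ) : ℤ)) = x ^ (2 + q + 1) / x ^ (2 * (2 + q - 2) + 1) := by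
    rw [← zpow_natCast, ← zpow_natCast, ← zpow_sub₀ hx0, Nat.add_sub_cancel_left]
    congr 1
    push_cast
    ring
  rw [e]
  simp only [Pi.div_apply]
  rw [div_div_div_eq, div_mul_eq_mul_div, div_div, mul_comm (x ^ (2 + q + 1))]
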